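/- For all integers n ≥ b ≥ 2, the number of (n,b)-domino towers T satisfying the additional conditions that (−1,1) ∈ T (a level-1 domino overhangs the base on the left, with its right end in the column of the left end of the base) and (2b−1,1) ∉ T (no level-1 domino extends past the base on the right) equals C(2n−3, n−b−1), with the convention C(m, j) = 0 for j < 0. -/

import Mathlib

/-- `T` is an (n,b)-domino tower: a finite set of pairs `(x, y)` where `(x, y) ∈ T` means a
horizontal 1×2 domino occupies columns `x` and `x+1` at level `y`. -/
def IsDominoTower (n b : ℕ) (T : Finset (ℤ × ℕ)) : Prop :=
  T.card = n ∧
  (∀ x : ℤ, (x, 0) ∈ T ↔ ∃ i : ℕ, i < b ∧ x = 2 * (i : ℤ)) ∧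
  (∀ x x' : ℤ, ∀ y : ℕ, (x, y) ∈ T → (x', y) ∈ T → x ≠ x' → 2 ≤ |x - x'|) ∧
  (∀ x : ℤ, ∀ y : ℕ, (x, y + 1) ∈ T → ∃ x' : ℤ, (x', y) ∈ T ∧ |x - x'| ≤ 1)

/-- The binomial coefficient `C(m, j)` with an integer lower index, extended by the convention
that it is `0` whenever `j < 0` (and, via `Nat.choose`, whenever `j > m`). -/
def binom (m : ℕ) (j : ℤ) : ℕ := if 0 ≤ j then m.choose j.toNat else 0

namespace DT

/-- independent sets of domino positions -/
def Ind (S : Finset ℤ) : Prop := ∀ x ∈ S, ∀ y ∈ S, x < y → x + 2 ≤ y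

instance (S : Finset ℤ) : Decidable (Ind S) := by unfold Ind; infer_instance

/-- neighbourhood -/
def Nb (U : Finset ℤ) : Finset ℤ := U.biUnion (fun x => {x - 1, x, x + 1})

theorem mem_Nb {U : Finset ℤ} {x : ℤ} : x ∈ Nb U ↔ ∃ u ∈ U, u - 1 ≤ x ∧ x ≤ u + 1 := by
  unfold Nb
  simp only [Finset.mem_biUnion, Finset.mem_insert, Finset.mem_singleton]
  constructor
  · rintro ⟨u, hu, h⟩; exact ⟨u, hu, by omega, by omega⟩
  · rintro ⟨u, hu, h⟩; exact ⟨u, hu, by omega⟩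

/-- independent subsets -/
def II (X : Finset ℤ) : Finset (Finset ℤ) := X.powerset.filter Ind

theorem mem_II {X S : Finset ℤ} : S ∈ II X ↔ S ⊆ X ∧ Ind S := by
  simp [II]

/-- put `T` on top of the row `S` -/
def up (S : Finset ℤ) (T : Finset (ℤ × ℕ)) : Finset (ℤ × ℕ) :=
  S.image (fun x => (x, 0)) ∪ T.image (fun p => (p.1, p.2 + 1))

theorem mem_up_zero {S : Finset ℤ} {T : Finset (ℤ × ℕ)} {x : ℤ} : (x, 0) ∈ up S T ↔ x ∈ S := by
  simp [up]

theorem mem_up_succ {S : Finset ℤ} {T : Finset (ℤ × ℕ)} {x : ℤ} {y : ℕ} :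
    (x, y + 1) ∈ up S T ↔ (x, y) ∈ T := by
  simp [up]

theorem up_inj (S : Finset ℤ) : Function.Injective (up S) := by
  intro T T' h
  ext ⟨x, y⟩
  rw [← mem_up_succ (S := S), h, mem_up_succ]

theorem card_up (S : Finset ℤ) (T : Finset (ℤ × ℕ)) : (up S T).card = S.card + T.card := by
  unfold up
  rw [Finset.card_union_of_disjoint, Finset.card_image_of_injective, Finset.card_image_of_injective]
  · rintro ⟨a, b⟩ ⟨c, d⟩ h; simp_all
  · intro a b h; simpa using h
  · rw [Finset.disjoint_left]; rintro ⟨a, b⟩ h1 h2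
    simp only [Finset.mem_image, Prod.mk.injEq] at h1 h2
    obtain ⟨_, _, _, h⟩ := h1
    obtain ⟨_, _, _, h'⟩ := h2
    omega

/-- tower with base `S` -/
def IsTow (n : ℕ) (S : Finset ℤ) (T : Finset (ℤ × ℕ)) : Prop :=
  T.card = n ∧
  (∀ x : ℤ, (x, 0) ∈ T ↔ x ∈ S) ∧
  (∀ x x' : ℤ, ∀ y : ℕ, (x, y) ∈ T → (x', y) ∈ T → x ≠ x' → 2 ≤ |x - x'|) ∧
  (∀ x : ℤ, ∀ y : ℕ, (x, y + 1) ∈ T → ∃ x' : ℤ, (x', y) ∈ T ∧ |x - x'| ≤ 1)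

/-- all towers with base `S` -/
def W (n : ℕ) (S : Finset ℤ) : Finset (Finset (ℤ × ℕ)) :=
  if S = ∅ then (if n = 0 then {∅} else ∅)
  else if S.card ≤ n then
    (II (Nb S)).biUnion (fun S' => (W (n - S.card) S').image (up S))
  else ∅
termination_by n
decreasing_by
  have := Finset.card_pos.2 (Finset.nonempty_iff_ne_empty.2 ‹_›)
  omega

theorem tow_step {n : ℕ} {S : Finset ℤ} (hS : Ind S) {T : Finset (ℤ × ℕ)} :
    IsTow n S T ↔ S.card ≤ n ∧ ∃ S' ∈ II (Nb S), ∃ T', IsTow (n - S.card) S' T' ∧ up S T' = T := by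
  constructor
  · rintro ⟨h1, h2, h3, h4⟩
    set T' : Finset (ℤ × ℕ) := (T.filter (fun p => p.2 ≠ 0)).image (fun p => (p.1, p.2 - 1)) with hT'
    have hm : ∀ x y, (x, y) ∈ T' ↔ (x, y + 1) ∈ T := by
      intro x y
      simp only [hT', Finset.mem_image, Finset.mem_filter, Prod.mk.injEq, Prod.exists]
      constructor
      · rintro ⟨a, b, ⟨h, h'⟩, rfl, rfl⟩
        dsimp at h'
        rwa [Nat.sub_add_cancel (by omega)]
      · intro h; exact ⟨x, y + 1, ⟨h, by simp⟩, rfl, by simp⟩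
    have hu : up S T' = T := by
      ext ⟨x, y⟩
      cases y with
      | zero => rw [mem_up_zero, h2]
      | succ y => rw [mem_up_succ, hm]
    have hc : S.card + T'.card = n := by rw [← card_up, hu, h1]
    refine ⟨by omega, (T.filter (fun p => p.2 = 1)).image Prod.fst, ?_, T', ⟨by omega, ?_, ?_, ?_⟩, hu⟩
    · rw [mem_II]
      constructor
      · intro x hx
        simp only [Finset.mem_image, Finset.mem_filter, Prod.exists] at hx
        obtain ⟨a, b, ⟨h, rfl⟩, rfl⟩ := hx
        obtain ⟨x', h5, h6⟩ := h4 _ _ h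
        rw [abs_le] at h6
        exact mem_Nb.2 ⟨x', (h2 _).1 h5, by omega, by omega⟩
      · intro x hx z hz hxz
        simp only [Finset.mem_image, Finset.mem_filter, Prod.exists] at hx hz
        obtain ⟨a, b, ⟨h, rfl⟩, rfl⟩ := hx
        obtain ⟨a', b', ⟨h', hb⟩, rfl⟩ := hz
        dsimp at *
        subst hb
        have := h3 _ _ _ h h' (by omega)
        rw [le_abs] at this
        omega
    · intro x; rw [hm]; simp
    · intro x x' y h h'; exact h3 x x' (y+1) ((hm _ _).1 h) ((hm _ _).1 h')
    · intro x y h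
      obtain ⟨x', h5, h6⟩ := h4 _ _ ((hm _ _).1 h)
      exact ⟨x', (hm _ _).2 h5, h6⟩
  · rintro ⟨hc, S', hS', T', ⟨h1, h2, h3, h4⟩, rfl⟩
    rw [mem_II] at hS'
    refine ⟨by rw [card_up]; omega, fun x => mem_up_zero, ?_, ?_⟩
    · intro x x' y h h' hne
      cases y with
      | zero =>
        rw [mem_up_zero] at h h'
        rw [le_abs]
        rcases lt_or_gt_of_ne hne with hl | hl
        · have := hS _ h _ h' hl; omega
        · have := hS _ h' _ h hl; omega
      | succ y => 
        rw [mem_up_succ] at h h'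
        exact h3 _ _ _ h h' hne
    · intro x y h
      rw [mem_up_succ] at h
      cases y with
      | zero =>
        obtain ⟨u, hu, h5, h6⟩ := mem_Nb.1 (hS'.1 ((h2 x).1 h))
        exact ⟨u, mem_up_zero.2 hu, by rw [abs_le]; omega⟩
      | succ y =>
        obtain ⟨x', h5, h6⟩ := h4 _ _ h
        exact ⟨x', mem_up_succ.2 h5, h6⟩

theorem tow_empty {n : ℕ} {T : Finset (ℤ × ℕ)} : IsTow n ∅ T ↔ n = 0 ∧ T = ∅ := by
  constructor
  · rintro ⟨h1, h2, h3, h4⟩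
    have h : ∀ y x, (x, y) ∉ T := by
      intro y
      induction y with
      | zero => intro x h; simpa using (h2 x).1 h
      | succ y ih => intro x h; obtain ⟨x', h5, _⟩ := h4 _ _ h; exact ih _ h5
    have : T = ∅ := by
      rw [Finset.eq_empty_iff_forall_notMem]; rintro ⟨x, y⟩; exact h _ _
    subst this
    exact ⟨by simpa using h1.symm, rfl⟩
  · rintro ⟨rfl, rfl⟩; simp [IsTow]

theorem mem_W (n : ℕ) : ∀ S, Ind S → ∀ T, T ∈ W n S ↔ IsTow n S T := by
  induction n using Nat.strong_induction_on with
  | _ n ih =>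
  intro S hS T
  rw [W]
  split_ifs with h1 h2 h3
  · subst h1; subst h2; simp [tow_empty]
  · subst h1; simp [tow_empty, h2]
  · have := Finset.card_pos.2 (Finset.nonempty_iff_ne_empty.2 h1)
    rw [tow_step hS]
    simp only [Finset.mem_biUnion, Finset.mem_image, h3, true_and]
    refine exists_congr fun S' => and_congr_right fun hS' => exists_congr fun T' => ?_
    rw [ih _ (by omega) S' (mem_II.1 hS').2]
  · rw [tow_step hS]; simp [h3]

/-- number of towers -/
def F (n : ℕ) (S : Finset ℤ) : ℕ := (W n S).card

theorem F_zero {n : ℕ} {S : Finset ℤ} (h : n < S.card) : F n S = 0 := by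
  have : S ≠ ∅ := by rintro rfl; simp at h
  unfold F; rw [W, if_neg this, if_neg (by omega)]; rfl

theorem card_filt (n : ℕ) (S : Finset ℤ) (Q : Finset (Finset ℤ)) (hQ : ∀ S' ∈ Q, Ind S') :
    (Q.biUnion (fun S' => (W n S').image (up S))).card = ∑ S' ∈ Q, F n S' := by
  rw [Finset.card_biUnion]
  · refine Finset.sum_congr rfl fun S' _ => ?_
    rw [Finset.card_image_of_injective _ (up_inj S)]; rfl
  · intro S1 h1 S2 h2 hne
    dsimp only [Function.onFun]
    rw [Finset.disjoint_left]
    intro T hT1 hT2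
    rw [Finset.mem_image] at hT1 hT2
    obtain ⟨T1, hT1, rfl⟩ := hT1
    obtain ⟨T2, hT2, he⟩ := hT2
    have := up_inj S he
    subst this
    rw [mem_W _ _ (hQ _ ‹_›)] at hT1 hT2
    apply hne
    ext x
    rw [← hT1.2.1, ← hT2.2.1]

theorem F_step {n : ℕ} {S : Finset ℤ} (h : S.Nonempty) :
    F (n + S.card) S = ∑ S' ∈ II (Nb S), F n S' := by
  rw [F, W, if_neg h.ne_empty, if_pos (by omega), Nat.add_sub_cancel, card_filt]
  intro S' h; exact (mem_II.1 h).2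

theorem sub_Nb (A : Finset ℤ) : A ⊆ Nb A := fun x hx => mem_Nb.2 ⟨x, hx, by omega, by omega⟩

theorem Ind_union {A B : Finset ℤ} (hA : Ind A) (hB : Ind B) (h : ∀ x ∈ A, x ∉ Nb B) :
    Ind (A ∪ B) := by
  have h' : ∀ x ∈ A, ∀ y ∈ B, ¬ (y - 1 ≤ x ∧ x ≤ y + 1) := fun x hx y hy hh =>
    h x hx (mem_Nb.2 ⟨y, hy, hh⟩)
  intro x hx y hy hxy
  rw [Finset.mem_union] at hx hy
  rcases hx with hx | hx <;> rcases hy with hy | hy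
  · exact hA _ hx _ hy hxy
  · have := h' _ hx _ hy; omega
  · have := h' _ hy _ hx; omega
  · exact hB _ hx _ hy hxy

theorem Ind_mono {A B : Finset ℤ} (hB : Ind B) (h : A ⊆ B) : Ind A :=
  fun x hx y hy => hB x (h hx) y (h hy)

theorem removal (N : ℕ) : ∀ (n : ℕ) (U A : Finset ℤ), n + U.card = N → Ind (U ∪ A) → Disjoint U A →
    F (n + U.card) (U ∪ A) = ∑ B ∈ II (Nb U \ Nb A), F n (B ∪ A) := by
  induction N using Nat.strong_induction_on with
  | _ N ih =>
  intro n U A hN hI hd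
  rcases U.eq_empty_or_nonempty with rfl | hU
  · have : II (Nb ∅ \ Nb A) = {∅} := by
      ext S; simp only [mem_II, Nb, Finset.biUnion_empty, Finset.empty_sdiff, Finset.subset_empty,
        Finset.mem_singleton]
      constructor
      · exact fun h => h.1
      · rintro rfl; exact ⟨rfl, by intro x hx; simp at hx⟩
    rw [this]; simp
  have hUp := hU.card_pos
  rcases lt_or_ge n A.card with hlt | hge
  · rw [F_zero, Finset.sum_eq_zero]
    · intro B _
      apply F_zero
      exact lt_of_lt_of_le hlt (Finset.card_le_card Finset.subset_union_right)
    · rw [Finset.card_union_of_disjoint hd]; omega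
  obtain ⟨m, rfl⟩ := Nat.exists_eq_add_of_le' hge
  have hA : Ind A := Ind_mono hI Finset.subset_union_right
  have e1 : m + A.card + U.card = m + (U ∪ A).card := by
    rw [Finset.card_union_of_disjoint hd]; omega
  rw [e1, F_step (hU.mono Finset.subset_union_left)]
  have e2 : ∀ B ∈ II (Nb U \ Nb A), F (m + A.card) (B ∪ A) =
      ∑ C ∈ II (Nb A \ Nb B), F m (C ∪ B) := by
    intro B hB
    rw [mem_II] at hB
    rw [Finset.union_comm B A]
    apply ih (m + A.card) (by omega) _ _ _ rfl
    · rw [Finset.union_comm]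
      exact Ind_union hB.2 hA fun x hx => (Finset.mem_sdiff.1 (hB.1 hx)).2
    · rw [Finset.disjoint_left]
      intro x hx hx'
      exact (Finset.mem_sdiff.1 (hB.1 hx')).2 (sub_Nb _ hx)
  rw [Finset.sum_congr rfl e2, Finset.sum_sigma']
  symm
  refine Finset.sum_bij' (fun p _ => p.2 ∪ p.1) (fun S _ => ⟨S \ Nb A, S ∩ Nb A⟩) ?_ ?_ ?_ ?_ ?_
  · rintro ⟨B, C⟩ h
    simp only [Finset.mem_sigma, mem_II] at h ⊢
    obtain ⟨⟨h1, h2⟩, h3, h4⟩ := h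
    refine ⟨?_, Ind_union h4 h2 fun x hx => (Finset.mem_sdiff.1 (h3 hx)).2⟩
    intro x hx
    have : x ∈ Nb A ∨ x ∈ Nb U := by
      rcases Finset.mem_union.1 hx with hx | hx
      · exact .inl (Finset.mem_sdiff.1 (h3 hx)).1
      · exact .inr (Finset.mem_sdiff.1 (h1 hx)).1
    rcases this with h | h <;> obtain ⟨u, hu, h⟩ := mem_Nb.1 h
    · exact mem_Nb.2 ⟨u, Finset.mem_union_right _ hu, h⟩
    · exact mem_Nb.2 ⟨u, Finset.mem_union_left _ hu, h⟩
  · intro S h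
    simp only [Finset.mem_sigma, mem_II] at h ⊢
    obtain ⟨h1, h2⟩ := h
    refine ⟨⟨?_, Ind_mono h2 Finset.sdiff_subset⟩, ?_, Ind_mono h2 Finset.inter_subset_left⟩
    · intro x hx
      rw [Finset.mem_sdiff] at hx ⊢
      refine ⟨?_, hx.2⟩
      obtain ⟨u, hu, h⟩ := mem_Nb.1 (h1 hx.1)
      rcases Finset.mem_union.1 hu with hu | hu
      · exact mem_Nb.2 ⟨u, hu, h⟩
      · exact absurd (mem_Nb.2 ⟨u, hu, h⟩) hx.2
    · intro x hx
      rw [Finset.mem_inter] at hx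
      rw [Finset.mem_sdiff]
      refine ⟨hx.2, fun h => ?_⟩
      obtain ⟨u, hu, h⟩ := mem_Nb.1 h
      rw [Finset.mem_sdiff] at hu
      have hne : x ≠ u := by rintro rfl; exact hu.2 hx.2
      rcases lt_or_gt_of_ne hne with hl | hl
      · have := h2 _ hx.1 _ hu.1 hl; omega
      · have := h2 _ hu.1 _ hx.1 hl; omega
  · rintro ⟨B, C⟩ h
    simp only [Finset.mem_sigma, mem_II] at h
    obtain ⟨⟨h1, h2⟩, h3, h4⟩ := h
    have g1 : ∀ x ∈ B, x ∉ Nb A := fun x hx => (Finset.mem_sdiff.1 (h1 hx)).2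
    have g2 : ∀ x ∈ C, x ∈ Nb A := fun x hx => (Finset.mem_sdiff.1 (h3 hx)).1
    have q1 : (C ∪ B) \ Nb A = B := by
      ext x; simp only [Finset.mem_sdiff, Finset.mem_union]; have := g1 x; have := g2 x; tauto
    have q2 : (C ∪ B) ∩ Nb A = C := by
      ext x; simp only [Finset.mem_inter, Finset.mem_union]; have := g1 x; have := g2 x; tauto
    dsimp only
    rw [q1, q2]
  · intro S h
    dsimp only
    ext x; simp only [Finset.mem_inter, Finset.mem_union, Finset.mem_sdiff]; tauto
  · intro p hp; rfl

/-- coefficients -/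
def d : ℕ → ℕ → ℤ
  | 0, _ => 0
  | m + 1, j => (2 * m + 1).choose (m + 1 + j)

theorem d_succ (n j : ℕ) : d (n + 1) (j + 1) = d n j + 2 * d n (j + 1) + d n (j + 2) := by
  cases n with
  | zero => simp [d, Nat.choose_eq_zero_of_lt]
  | succ m =>
    simp only [d]
    have : 2 * (m + 1) + 1 = (2 * m + 1) + 1 + 1 := by ring
    rw [this, show m + 1 + 1 + (j + 1) = (m + 1 + j + 1) + 1 by ring, Nat.choose_succ_succ,
      Nat.choose_succ_succ, Nat.choose_succ_succ _ (m + 1 + j + 1)]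
    simp only [Nat.succ_eq_add_one, ← add_assoc]
    push_cast; ring

theorem d_base (n : ℕ) : d (n + 1) 0 = (if n = 0 then 1 else 0) + 3 * d n 0 + d n 1 := by
  cases n with
  | zero => simp [d]
  | succ m =>
    simp only [d]
    have : 2 * (m + 1) + 1 = (2 * m + 1) + 1 + 1 := by ring
    rw [this, show m + 1 + 1 + 0 = (m + 1) + 1 by ring, Nat.choose_succ_succ,
      Nat.choose_succ_succ, Nat.choose_succ_succ _ (m + 1)]
    have h : (2 * m + 1).choose m = (2 * m + 1).choose (m + 1) := by
      apply Nat.choose_symm_of_eq_add; ring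
    simp only [Nat.succ_eq_add_one, h]
    push_cast; simp; ring

open Polynomial in
/-- the functional -/
noncomputable def phi (n : ℕ) : ℤ[X] →ₗ[ℤ] ℤ :=
  Polynomial.lsum (fun j => (d n j) • LinearMap.id)

open Polynomial in
theorem phi_X (n j : ℕ) : phi n (X ^ j) = d n j := by
  simp [phi, Polynomial.lsum, ← Polynomial.monomial_one_right_eq_X_pow, Polynomial.sum_monomial_index]

open Polynomial in
theorem phi_X_mul (n : ℕ) (p : ℤ[X]) : phi (n + 1) (X * p) = phi n ((1 + X) ^ 2 * p) := by
  induction p using Polynomial.induction_on' with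
  | add p q hp hq => rw [mul_add, mul_add, map_add, map_add, hp, hq]
  | monomial j a =>
    have e : monomial j a = a • (X ^ j : ℤ[X]) := by
      rw [← Polynomial.monomial_one_right_eq_X_pow, smul_monomial]; simp
    rw [e, mul_smul_comm, mul_smul_comm, map_smul, map_smul]
    congr 1
    rw [← pow_succ', phi_X, d_succ]
    have : (1 + X : ℤ[X]) ^ 2 * X ^ j = X ^ j + (2 : ℤ) • X ^ (j + 1) + X ^ (j + 2) := by
      simp only [zsmul_eq_mul]; push_cast; ring
    rw [this, map_add, map_add, map_smul, phi_X, phi_X, phi_X]; rfl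

/-- sets from gaps -/
def G : ℤ → List ℕ → Finset ℤ
  | s, [] => {s}
  | s, c :: l => insert s (G (s + c + 2) l)

open Polynomial in
/-- `1 + X + ... + X^c` without last -/
noncomputable def Q (c : ℕ) : ℤ[X] := X * ∑ j ∈ Finset.range c, X ^ j

open Polynomial in
/-- gap polynomial -/
noncomputable def pp : List ℕ → ℤ[X]
  | [] => 1
  | c :: l => Q (c + 1) * pp l

theorem G_ge (l : List ℕ) : ∀ s x, x ∈ G s l → s ≤ x := by
  induction l with
  | nil => intro s x h; simp [G] at h; omega
  | cons c l ih =>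
    intro s x h
    simp only [G, Finset.mem_insert] at h
    rcases h with h | h
    · omega
    · have := ih _ _ h; omega

theorem G_self (l : List ℕ) (s : ℤ) : s ∈ G s l := by
  cases l <;> simp [G]

theorem G_ind (l : List ℕ) : ∀ s, Ind (G s l) := by
  induction l with
  | nil => intro s x hx y hy h; simp [G] at hx hy; omega
  | cons c l ih =>
    intro s x hx y hy h
    simp only [G, Finset.mem_insert] at hx hy
    rcases hx with hx | hx <;> rcases hy with hy | hy
    · omega
    · have := G_ge _ _ _ hy; omega
    · have := G_ge _ _ _ hx; omega
    · exact ih _ _ hx _ hy h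

theorem II_two (s : ℤ) : II {s - 1, s} = {∅, {s - 1}, {s}} := by
  ext S
  simp only [mem_II, Finset.mem_insert, Finset.mem_singleton]
  constructor
  · rintro ⟨h1, h2⟩
    have g1 : ∀ x ∈ S, x = s - 1 ∨ x = s := by intro x hx; simpa using h1 hx
    have k1 : ¬ (s - 1 ∈ S ∧ s ∈ S) := fun h => by have := h2 _ h.1 _ h.2; omega
    by_cases ha : s - 1 ∈ S
    · right; left; ext x; simp only [Finset.mem_singleton]
      constructor
      · intro hx; rcases g1 x hx with rfl | rfl <;> tauto
      · rintro rfl; exact ha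
    by_cases hb : s ∈ S
    · right; right; ext x; simp only [Finset.mem_singleton]
      constructor
      · intro hx; rcases g1 x hx with rfl | rfl <;> tauto
      · rintro rfl; exact hb
    left
    rw [Finset.eq_empty_iff_forall_notMem]
    intro x hx; rcases g1 x hx with rfl | rfl <;> tauto
  · rintro (rfl | rfl | rfl) <;> refine ⟨by simp, ?_⟩ <;> intro x hx y hy h <;> simp at hx hy <;> omega

theorem II_three (s : ℤ) : II {s - 1, s, s + 1} = {∅, {s - 1}, {s}, {s + 1}, {s - 1, s + 1}} := by
  ext S
  simp only [mem_II, Finset.mem_insert, Finset.mem_singleton]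
  constructor
  · rintro ⟨h1, h2⟩
    have g1 : ∀ x ∈ S, x = s - 1 ∨ x = s ∨ x = s + 1 := by intro x hx; simpa using h1 hx
    have k1 : ¬ (s - 1 ∈ S ∧ s ∈ S) := fun h => by have := h2 _ h.1 _ h.2; omega
    have k2 : ¬ (s ∈ S ∧ s + 1 ∈ S) := fun h => by have := h2 _ h.1 _ h.2; omega
    by_cases ha : s - 1 ∈ S <;> by_cases hc : s + 1 ∈ S
    · right; right; right; right
      ext x; simp only [Finset.mem_singleton, Finset.mem_insert]
      constructor
      · intro hx; rcases g1 x hx with rfl | rfl | rfl <;> tauto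
      · rintro (rfl | rfl) <;> assumption
    · right; left; ext x; simp only [Finset.mem_singleton]
      constructor
      · intro hx; rcases g1 x hx with rfl | rfl | rfl <;> tauto
      · rintro rfl; exact ha
    · right; right; right; left; ext x; simp only [Finset.mem_singleton]
      constructor
      · intro hx; rcases g1 x hx with rfl | rfl | rfl <;> tauto
      · rintro rfl; exact hc
    by_cases hb : s ∈ S
    · right; right; left; ext x; simp only [Finset.mem_singleton]
      constructor
      · intro hx; rcases g1 x hx with rfl | rfl | rfl <;> tauto
      · rintro rfl; exact hb
    left
    rw [Finset.eq_empty_iff_forall_notMem]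
    intro x hx; rcases g1 x hx with rfl | rfl | rfl <;> tauto
  · rintro (rfl | rfl | rfl | rfl | rfl) <;> refine ⟨by intro x hx; simp at hx ⊢; try omega, ?_⟩ <;> intro x hx y hy h <;> simp at hx hy <;> omega

theorem sum_two (s : ℤ) (f : Finset ℤ → ℕ) :
    ∑ B ∈ II {s - 1, s}, f B = f ∅ + f {s - 1} + f {s} := by
  rw [II_two, Finset.sum_insert, Finset.sum_insert, Finset.sum_singleton, add_assoc]
  · simp
  · simp [Finset.ext_iff]

theorem sum_three (s : ℤ) (f : Finset ℤ → ℕ) :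
    ∑ B ∈ II {s - 1, s, s + 1}, f B = f ∅ + f {s - 1} + f {s} + f {s + 1} + f {s - 1, s + 1} := by
  have h1 : ({s - 1} : Finset ℤ) ≠ {s - 1, s + 1} := fun h => by
    have : s + 1 ∈ ({s - 1} : Finset ℤ) := by rw [h]; simp
    simp at this; omega
  have h2 : ({s} : Finset ℤ) ≠ {s - 1, s + 1} := fun h => by
    have : s + 1 ∈ ({s} : Finset ℤ) := by rw [h]; simp
    simp at this
  have h3 : ({s + 1} : Finset ℤ) ≠ {s - 1, s + 1} := fun h => by
    have : s - 1 ∈ ({s + 1} : Finset ℤ) := by rw [h]; simp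
    simp at this; omega
  rw [II_three, Finset.sum_insert, Finset.sum_insert, Finset.sum_insert, Finset.sum_insert,
    Finset.sum_singleton]
  · ring
  · simpa using h3
  · simpa using h2
  · simp only [Finset.mem_insert, Finset.mem_singleton, Finset.singleton_inj, not_or]
    exact ⟨by omega, by omega, h1⟩
  · simp only [Finset.mem_insert, Finset.mem_singleton, not_or]
    exact ⟨(Finset.singleton_ne_empty _).symm, (Finset.singleton_ne_empty _).symm,
      (Finset.singleton_ne_empty _).symm, (Finset.insert_ne_empty _ _).symm⟩

theorem Nb_singleton (s : ℤ) : Nb {s} = {s - 1, s, s + 1} := by simp [Nb]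

theorem Nb_G_cons (c : ℕ) (l : List ℕ) (s : ℤ) :
    Nb {s} \ Nb (G (s + c + 2) l) = if c = 0 then {s - 1, s} else {s - 1, s, s + 1} := by
  have key : ∀ x, x ≤ s + 1 → (x ∈ Nb (G (s + c + 2) l) ↔ c = 0 ∧ x = s + 1) := by
    intro x hx
    rw [mem_Nb]
    constructor
    · rintro ⟨u, hu, h⟩; have := G_ge _ _ _ hu; omega
    · rintro ⟨rfl, rfl⟩; exact ⟨_, G_self _ _, by simp; omega⟩
  ext x
  rw [Nb_singleton, Finset.mem_sdiff]
  simp only [Finset.mem_insert, Finset.mem_singleton]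
  by_cases hx : x ≤ s + 1
  · rw [key x hx]
    split_ifs <;> simp <;> omega
  · split_ifs <;> simp <;> omega

open Polynomial in
theorem Q_succ (c : ℕ) : Q (c + 1) = Q c + X ^ (c + 1) := by
  unfold Q; rw [Finset.sum_range_succ]; ring

open Polynomial in
theorem Q_succ' (c : ℕ) : Q (c + 1) = X * Q c + X := by
  unfold Q
  rw [Finset.sum_range_succ']
  simp only [pow_succ', ← Finset.mul_sum]
  ring

open Polynomial in
theorem Q_id (c : ℕ) : (1 + X) ^ 2 * ∑ j ∈ Finset.range (c + 1), (X : ℤ[X]) ^ j =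
    1 + Q (c + 2) + Q (c + 1) + Q c + X * Q c := by
  have h1 : ∑ j ∈ Finset.range (c + 1), (X : ℤ[X]) ^ j = 1 + Q c := by
    rw [Finset.sum_range_succ', Q, Finset.mul_sum]; simp [pow_succ', add_comm]
  rw [h1, Q_succ' (c + 1), Q_succ' c]; ring

theorem Q_zero : Q 0 = 0 := by simp [Q]

open Polynomial in
theorem Q_one : Q 1 = X := by simp [Q]

theorem F_empty (n : ℕ) : F n ∅ = if n = 0 then 1 else 0 := by
  rw [F, W]; simp; split_ifs <;> simp

theorem F_G (n : ℕ) : ∀ (l : List ℕ) (s : ℤ), (F n (G s l) : ℤ) = phi n (pp l) := by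
  induction n with
  | zero =>
    intro l s
    rw [F_zero (Finset.card_pos.2 ⟨s, G_self _ _⟩)]
    have : phi 0 = 0 := by
      ext; simp [phi, Polynomial.lsum, d]
    simp [this]
  | succ n ih =>
    intro l s
    cases l with
    | nil =>
      have h := removal (n + 1) n {s} ∅ (by simp) (by simpa [G] using G_ind [] s) (by simp)
      have e : Nb {s} \ Nb ∅ = {s - 1, s, s + 1} := by rw [Nb_singleton]; simp [Nb]
      rw [e, sum_three] at h
      simp only [Finset.card_singleton, Finset.union_empty, F_empty] at h
      have e1 := ih [] (s - 1)
      have e2 := ih [] s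
      have e3 := ih [] (s + 1)
      have e4 := ih [0] (s - 1)
      simp only [G, pp, Q_one, mul_one, zero_add] at e1 e2 e3 e4 ⊢
      rw [show s - 1 + ((0 : ℕ) : ℤ) + 2 = s + 1 by push_cast; ring] at e4
      rw [h]; push_cast
      rw [e1, e2, e3, e4]
      have q0 := phi_X n 0
      have q1 := phi_X n 1
      have q2 := phi_X (n + 1) 0
      rw [pow_zero] at q0 q2
      rw [pow_one] at q1
      rw [q0, q1, q2, d_base]; ring
    | cons c l =>
      have hd : Disjoint {s} (G (s + c + 2) l) := by
        rw [Finset.disjoint_singleton_left]; intro h; have := G_ge _ _ _ h; omega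
      have h := removal (n + 1) n {s} (G (s + c + 2) l) (by simp)
        (by simpa [G] using G_ind (c :: l) s) hd
      rw [Nb_G_cons, Finset.card_singleton] at h
      have e0 := ih l (s + c + 2)
      have e1 := ih ((c + 1) :: l) (s - 1)
      have e2 := ih (c :: l) s
      have hp : phi (n + 1) (pp (c :: l)) = phi n (pp l) + phi n (pp ((c + 1) :: l))
          + phi n (pp (c :: l)) + phi n (Q c * pp l) + phi n (Q 1 * (Q c * pp l)) := by
        simp only [pp]
        have hQ : Q (c + 1) = Polynomial.X * ∑ j ∈ Finset.range (c + 1), Polynomial.X ^ j := rfl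
        conv_lhs => rw [hQ]
        rw [mul_assoc, phi_X_mul, ← mul_assoc, Q_id, ← map_add, ← map_add, ← map_add, ← map_add,
          Q_one]
        congr 1; ring
      rw [hp, ← e0, ← e1, ← e2]
      simp only [G] at *
      rw [← Finset.singleton_union, h]
      have k1 : s - 1 + ((c + 1 : ℕ) : ℤ) + 2 = s + c + 2 := by push_cast; ring
      rw [k1]
      rcases c with _ | c
      · rw [if_pos rfl, sum_two]
        simp [Q_zero]
      · rw [if_neg (by omega), sum_three]
        have e3 := ih (c :: l) (s + 1)
        have e4 := ih (0 :: c :: l) (s - 1)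
        simp only [G, pp] at e3 e4
        have k2 : s + 1 + (c : ℤ) + 2 = s + ((c + 1 : ℕ) : ℤ) + 2 := by push_cast; ring
        have k3 : s - 1 + ((0 : ℕ) : ℤ) + 2 = s + 1 := by push_cast; ring
        rw [k2] at e3
        rw [k3, k2] at e4
        rw [← e3, ← e4]
        simp [Finset.singleton_union, Finset.insert_union]

theorem G_rep (k : ℕ) : ∀ (s x : ℤ), x ∈ G s (List.replicate k 0) ↔
    ∃ i : ℕ, i ≤ k ∧ x = s + 2 * (i : ℤ) := by
  induction k with
  | zero => intro s x; simp [G]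
  | succ k ih =>
    intro s x
    simp only [List.replicate_succ, G, Finset.mem_insert, ih]
    constructor
    · rintro (rfl | ⟨i, hi, rfl⟩)
      · exact ⟨0, by omega, by simp⟩
      · exact ⟨i + 1, by omega, by push_cast; ring⟩
    · rintro ⟨i, hi, rfl⟩
      rcases i with _ | i
      · left; simp
      · right; exact ⟨i, by omega, by push_cast; ring⟩

theorem G_rep_card (k : ℕ) : ∀ s, (G s (List.replicate k 0)).card = k + 1 := by
  induction k with
  | zero => intro s; simp [G]
  | succ k ih =>
    intro s
    simp only [List.replicate_succ, G]
    rw [Finset.card_insert_of_notMem, ih]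
    intro h; have := G_ge _ _ _ h; simp at this

theorem mem_Nb_rep (k : ℕ) (s x : ℤ) : x ∈ Nb (G s (List.replicate k 0)) ↔
    s - 1 ≤ x ∧ x ≤ s + 2 * k + 1 := by
  rw [mem_Nb]
  constructor
  · rintro ⟨u, hu, h⟩
    obtain ⟨i, hi, rfl⟩ := (G_rep _ _ _).1 hu
    omega
  · rintro ⟨h1, h2⟩
    by_cases h : x ≤ s
    · exact ⟨s, G_self _ _, by omega, by omega⟩
    · refine ⟨s + 2 * (((x - s) / 2).toNat : ℤ), (G_rep _ _ _).2 ⟨_, ?_, rfl⟩, ?_, ?_⟩ <;> omega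

theorem pp_rep (k : ℕ) : pp (List.replicate k 0) = Polynomial.X ^ k := by
  induction k with
  | zero => simp [pp]
  | succ k ih => rw [List.replicate_succ, pp, ih, Q_one]; ring

/-- first reduction -/
theorem count_eq (m k : ℕ) :
    Nat.card {T : Finset (ℤ × ℕ) //
        IsDominoTower (m + (k + 1)) (k + 1) T ∧ ((-1 : ℤ), 1) ∈ T ∧
          ((2 * ((k + 1 : ℕ) : ℤ) - 1), 1) ∉ T} =
      ∑ S' ∈ (II (Nb (G 0 (List.replicate k 0)))).filter
        (fun S' => (-1 : ℤ) ∈ S' ∧ (2 * ((k + 1 : ℕ) : ℤ) - 1) ∉ S'), F m S' := by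
  rw [← card_filt m (G 0 (List.replicate k 0)) _ (fun S' h => (mem_II.1 (Finset.mem_filter.1 h).1).2)]
  have hI := G_ind (List.replicate k 0) 0
  have hc := G_rep_card k 0
  have hT : ∀ T, IsDominoTower (m + (k + 1)) (k + 1) T ↔
      IsTow (m + (k + 1)) (G 0 (List.replicate k 0)) T := by
    intro T
    unfold IsDominoTower IsTow
    simp only [G_rep, zero_add, Nat.lt_succ_iff]
  rw [← Nat.card_eq_finsetCard]
  apply Nat.card_congr
  apply Equiv.subtypeEquivRight
  intro T
  rw [hT, tow_step hI, hc, Nat.add_sub_cancel]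
  simp only [Finset.mem_biUnion, Finset.mem_filter, Finset.mem_image]
  constructor
  · rintro ⟨⟨_, S', hS', T', h, rfl⟩, h1, h2⟩
    have h1' := (h.2.1 _).1 ((mem_up_succ (y := 0)).1 h1)
    exact ⟨S', ⟨hS', h1', fun hh => h2 ((mem_up_succ (y := 0)).2 ((h.2.1 _).2 hh))⟩, T', (mem_W _ _ (mem_II.1 hS').2 _).2 h, rfl⟩
  · rintro ⟨S', ⟨hS', h1, h2⟩, T', h, rfl⟩
    rw [mem_W _ _ (mem_II.1 hS').2] at h
    refine ⟨⟨by omega, S', hS', T', h, rfl⟩, ?_, ?_⟩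
    · exact (mem_up_succ (y := 0)).2 ((h.2.1 _).2 h1)
    · intro hh; exact h2 ((h.2.1 _).1 ((mem_up_succ (y := 0)).1 hh))

theorem sum_fiber (m : ℕ) (U A X : Finset ℤ) (hA : Ind A) (h1 : ∀ x ∈ A, x ∉ Nb U)
    (hU : Ind U) (h2 : Nb U ⊆ X) (h3 : A ⊆ X) :
    ∑ S' ∈ (II X).filter (fun S' => S' \ Nb U = A), F m S' = F (m + U.card) (U ∪ A) := by
  rw [removal _ m U A rfl]
  · refine Finset.sum_bij' (fun S _ => S ∩ Nb U) (fun B _ => B ∪ A) ?_ ?_ ?_ ?_ ?_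
    · intro S hS
      simp only [Finset.mem_filter, mem_II] at hS ⊢
      obtain ⟨⟨h4, h5⟩, rfl⟩ := hS
      refine ⟨?_, Ind_mono h5 Finset.inter_subset_left⟩
      intro x hx
      rw [Finset.mem_inter] at hx
      rw [Finset.mem_sdiff]
      refine ⟨hx.2, fun h => ?_⟩
      obtain ⟨u, hu, h⟩ := mem_Nb.1 h
      rw [Finset.mem_sdiff] at hu
      have hne : x ≠ u := by rintro rfl; exact hu.2 hx.2
      rcases lt_or_gt_of_ne hne with hl | hl
      · have := h5 _ hx.1 _ hu.1 hl; omega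
      · have := h5 _ hu.1 _ hx.1 hl; omega
    · intro B hB
      simp only [Finset.mem_filter, mem_II] at hB ⊢
      have g1 : ∀ x ∈ B, x ∈ Nb U := fun x hx => (Finset.mem_sdiff.1 (hB.1 hx)).1
      refine ⟨⟨Finset.union_subset (fun x hx => h2 (g1 x hx)) h3,
        Ind_union hB.2 hA fun x hx => (Finset.mem_sdiff.1 (hB.1 hx)).2⟩, ?_⟩
      ext x; simp only [Finset.mem_sdiff, Finset.mem_union]; have := g1 x; have := h1 x; tauto
    · intro S hS
      simp only [Finset.mem_filter, mem_II] at hS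
      obtain ⟨_, rfl⟩ := hS
      ext x; simp only [Finset.mem_inter, Finset.mem_union, Finset.mem_sdiff]; tauto
    · intro B hB
      simp only [mem_II] at hB
      have g1 : ∀ x ∈ B, x ∈ Nb U := fun x hx => (Finset.mem_sdiff.1 (hB.1 hx)).1
      ext x; simp only [Finset.mem_inter, Finset.mem_union]; have := g1 x; have := h1 x; tauto
    · intro S hS
      simp only [Finset.mem_filter, mem_II] at hS
      obtain ⟨_, rfl⟩ := hS
      congr 1
      ext x; simp only [Finset.mem_inter, Finset.mem_union, Finset.mem_sdiff]; tauto
  · rw [Finset.union_comm]; exact Ind_union hA hU h1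
  · rw [Finset.disjoint_left]; intro x hx hx'; exact h1 x hx' (sub_Nb _ hx)

theorem sum_case_two (m : ℕ) :
    ((∑ S' ∈ (II (Nb (G 0 (List.replicate 1 0)))).filter
        (fun S' => (-1 : ℤ) ∈ S' ∧ (2 * ((1 + 1 : ℕ) : ℤ) - 1) ∉ S'), F m S' : ℕ) : ℤ) =
      d (m + 1) 1 := by
  have h : (II (Nb (G 0 (List.replicate 1 0)))).filter
        (fun S' => (-1 : ℤ) ∈ S' ∧ (2 * ((1 + 1 : ℕ) : ℤ) - 1) ∉ S') =
      {{-1}, {-1, 1}, {-1, 2}} := by decide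
  rw [h, Finset.sum_insert (by decide), Finset.sum_insert (by decide), Finset.sum_singleton]
  have e1 := F_G m [] (-1)
  have e2 := F_G m [0] (-1)
  have e3 := F_G m [1] (-1)
  simp only [G, pp] at e1 e2 e3
  norm_num at e1 e2 e3 ⊢
  rw [e1, e2, e3, ← phi_X, Q_one, Q_succ, Q_one, pow_one, ← mul_one Polynomial.X, phi_X_mul,
    ← map_add, ← map_add]
  congr 1; ring

theorem sum_case_three (m k : ℕ) :
    ((∑ S' ∈ (II (Nb (G 0 (List.replicate (k + 2) 0)))).filter
        (fun S' => (-1 : ℤ) ∈ S' ∧ (2 * ((k + 2 + 1 : ℕ) : ℤ) - 1) ∉ S'), F m S' : ℕ) : ℤ) =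
      d (m + k + 2) (k + 2) := by
  rw [← Finset.sum_filter_add_sum_filter_not _ (fun S' => (2 * k + 4 : ℤ) ∈ S')]
  have hUi := G_ind (List.replicate k 0) 2
  have hUc := G_rep_card k 2
  have hX := mem_Nb_rep (k + 2) 0
  have hN := mem_Nb_rep k 2
  have hG : ∀ x, x ∈ G 2 (List.replicate (k + 1) 0) ↔
      x ∈ G 2 (List.replicate k 0) ∨ x = 2 * k + 4 := by
    intro x
    rw [G_rep, G_rep]
    constructor
    · rintro ⟨i, hi, rfl⟩
      by_cases h : i ≤ k
      · exact .inl ⟨i, h, rfl⟩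
      · right; omega
    · rintro (⟨i, hi, rfl⟩ | rfl)
      · exact ⟨i, by omega, rfl⟩
      · exact ⟨k + 1, by omega, by push_cast; ring⟩
  have f1 := F_G (m + k + 1) (1 :: List.replicate (k + 1) 0) (-1)
  have f2 := F_G (m + k + 1) (1 :: List.replicate k 0) (-1)
  simp only [G, pp, pp_rep] at f1 f2
  norm_num at f1 f2
  set U := G 2 (List.replicate k 0) with hU
  set X := Nb (G 0 (List.replicate (k + 2) 0)) with hXd
  have a1 := sum_fiber m U {-1, 2 * (k : ℤ) + 4} X
    (by intro x hx y hy h; simp at hx hy; omega)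
    (by intro x hx; rw [hN]; simp at hx; omega) hUi
    (by intro x hx; rw [hX]; rw [hN] at hx; push_cast; omega)
    (by intro x hx; rw [hX]; simp at hx; push_cast; omega)
  have a2 := sum_fiber m U {-1} X
    (by intro x hx y hy h; simp at hx hy; omega)
    (by intro x hx; rw [hN]; simp at hx; omega) hUi
    (by intro x hx; rw [hX]; rw [hN] at hx; push_cast; omega)
    (by intro x hx; rw [hX]; simp at hx; push_cast; omega)
  have b0 : ∀ S' ∈ II X, (-1 : ℤ) ∈ S' → (2 * ((k + 2 + 1 : ℕ) : ℤ) - 1) ∉ S' →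
      ∀ x ∈ S', x ∉ Nb U → x = -1 ∨ x = 2 * k + 4 := by
    intro S' hS h1 h2 x hx hn
    rw [mem_II] at hS
    have g1 := (hX x).1 (hS.1 hx)
    rw [hN] at hn
    have g2 : x ≠ 0 := by rintro rfl; have := hS.2 _ h1 _ hx; omega
    have g3 : x ≠ (2 * ((k + 2 + 1 : ℕ) : ℤ) - 1) := by rintro rfl; exact h2 hx
    push_cast at g1 g3
    omega
  have b1 : ((II X).filter (fun S' => (-1 : ℤ) ∈ S' ∧ (2 * ((k + 2 + 1 : ℕ) : ℤ) - 1) ∉ S')).filter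
      (fun S' => (2 * k + 4 : ℤ) ∈ S') = (II X).filter (fun S' => S' \ Nb U = {-1, 2 * (k : ℤ) + 4}) := by
    ext S'
    simp only [Finset.mem_filter]
    constructor
    · rintro ⟨⟨h0, h1, h2⟩, h3⟩
      refine ⟨h0, ?_⟩
      ext x
      simp only [Finset.mem_sdiff, Finset.mem_insert, Finset.mem_singleton]
      constructor
      · rintro ⟨hx, hn⟩; exact b0 _ h0 h1 h2 _ hx hn
      · rintro (rfl | rfl)
        · exact ⟨h1, by rw [hN]; omega⟩
        · exact ⟨h3, by rw [hN]; omega⟩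
    · rintro ⟨h0, h⟩
      have g : ∀ x, x ∈ S' \ Nb U ↔ x = -1 ∨ x = 2 * k + 4 := by intro x; rw [h]; simp
      simp only [Finset.mem_sdiff] at g
      refine ⟨⟨h0, ((g _).2 (.inl rfl)).1, fun hh => ?_⟩, ((g _).2 (.inr rfl)).1⟩
      have := (g _).1 ⟨hh, by rw [hN]; push_cast; omega⟩
      push_cast at this
      omega
  have b2 : ((II X).filter (fun S' => (-1 : ℤ) ∈ S' ∧ (2 * ((k + 2 + 1 : ℕ) : ℤ) - 1) ∉ S')).filter
      (fun S' => ¬ (2 * k + 4 : ℤ) ∈ S') = (II X).filter (fun S' => S' \ Nb U = {-1}) := by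
    ext S'
    simp only [Finset.mem_filter]
    constructor
    · rintro ⟨⟨h0, h1, h2⟩, h3⟩
      refine ⟨h0, ?_⟩
      ext x
      simp only [Finset.mem_sdiff, Finset.mem_singleton]
      constructor
      · rintro ⟨hx, hn⟩
        rcases b0 _ h0 h1 h2 _ hx hn with h | rfl
        · exact h
        · exact absurd hx h3
      · rintro rfl
        exact ⟨h1, by rw [hN]; omega⟩
    · rintro ⟨h0, h⟩
      have g : ∀ x, x ∈ S' \ Nb U ↔ x = -1 := by intro x; rw [h]; simp
      simp only [Finset.mem_sdiff] at g
      refine ⟨⟨h0, ((g _).2 rfl).1, fun hh => ?_⟩, fun hh => ?_⟩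
      · have := (g _).1 ⟨hh, by rw [hN]; push_cast; omega⟩
        push_cast at this
        omega
      · have := (g _).1 ⟨hh, by rw [hN]; omega⟩
        omega
  rw [b1, b2, a1, a2, hUc, ← add_assoc]
  have c1 : U ∪ {-1, 2 * (k : ℤ) + 4} = insert (-1) (G 2 (List.replicate (k + 1) 0)) := by
    ext x; simp only [Finset.mem_union, Finset.mem_insert, Finset.mem_singleton, hG]; tauto
  have c2 : U ∪ {-1} = insert (-1) U := by
    ext x; simp only [Finset.mem_union, Finset.mem_insert, Finset.mem_singleton]; tauto
  rw [c1, c2]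
  push_cast
  have hk : (Polynomial.X : Polynomial ℤ) ^ (k + 2) = Polynomial.X * Polynomial.X ^ (k + 1) := by
    ring
  rw [f1, f2, ← phi_X, hk, phi_X_mul, ← map_add, Q_succ, Q_one]
  congr 1; ring

end DT

theorem domino_tower_count_C (n b : ℕ) (hb : 2 ≤ b) (hbn : b ≤ n) :
    Nat.card {T : Finset (ℤ × ℕ) //
        IsDominoTower n b T ∧ ((-1 : ℤ), 1) ∈ T ∧ ((2 * (b : ℤ) - 1), 1) ∉ T} =
      binom (2 * n - 3) ((n : ℤ) - b - 1) := by
  obtain ⟨m, rfl⟩ := Nat.exists_eq_add_of_le' hbn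
  obtain ⟨k, rfl⟩ := Nat.exists_eq_add_of_le' hb
  have key : ((Nat.card {T : Finset (ℤ × ℕ) //
        IsDominoTower (m + (k + 2)) (k + 2) T ∧ ((-1 : ℤ), 1) ∈ T ∧
          ((2 * ((k + 2 : ℕ) : ℤ) - 1), 1) ∉ T} : ℕ) : ℤ) = DT.d (m + k + 1) (k + 1) := by
    rw [DT.count_eq m (k + 1)]
    rcases k with _ | k
    · exact DT.sum_case_two m
    · exact DT.sum_case_three m k
  have e : DT.d (m + k + 1) (k + 1) = ((2 * (m + k) + 1).choose (m + k + 1 + (k + 1)) : ℕ) := rfl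
  rw [e] at key
  rw [Nat.cast_inj.1 key, binom]
  have e2 : 2 * (m + (k + 2)) - 3 = 2 * (m + k) + 1 := by omega
  rw [e2]
  rcases m with _ | m
  · rw [if_neg (by push_cast; omega), Nat.choose_eq_zero_of_lt (by omega)]
  · rw [if_pos (by push_cast; omega)]
    have : (((m + 1 + (k + 2) : ℕ) : ℤ) - (k + 2 : ℕ) - 1).toNat = m := by omega
    rw [this]
    apply Nat.choose_symm_of_eq_add
    ring
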